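/- Let p be an odd prime. For fixed p and r, there are only finitely many finite p-groups of coclass r that are PF-groups; in particular, every finite p-group of coclass r and order at least p^{2p^r + r} is not a PF-group. -/

import Mathlib

/-- The subgroup generated by `p`-th powers of elements of `N`. -/
def pPow {G : Type*} [Group G] (p : ℕ) (N : Subgroup G) : Subgroup G :=
  Subgroup.closure ((fun x => x ^ p) '' (N : Set G))

theorem pPow_normal {G : Type*} [Group G] (p : ℕ) {N : Subgroup G} (hN : N.Normal) :
    (pPow p N).Normal := by
  constructor
  intro x hx g
  have h : pPow p N ≤ Subgroup.comap (MulAut.conj g).toMonoidHom (pPow p N) := by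
    rw [pPow, Subgroup.closure_le]
    rintro - ⟨n, hn, rfl⟩
    have : (MulAut.conj g) (n ^ p) = (g * n * g⁻¹) ^ p := by
      simp [MulAut.conj_apply, conj_pow]
    refine Subgroup.mem_comap.2 ?_
    show (MulAut.conj g) (n ^ p) ∈ _
    rw [this]
    exact Subgroup.subset_closure ⟨g * n * g⁻¹, hN.conj_mem n hn g, rfl⟩
  simpa using h hx

theorem normal_sSup {G : Type*} [Group G] {S : Set (Subgroup G)}
    (hS : ∀ N ∈ S, N.Normal) : (sSup S).Normal := by
  constructor
  intro x hx g
  have h : sSup S ≤ Subgroup.comap (MulAut.conj g).toMonoidHom (sSup S) := by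
    refine sSup_le fun N hN => le_trans ?_ (Subgroup.comap_mono (le_sSup hN))
    intro n hn
    exact Subgroup.mem_comap.2 (by simpa using (hS N hN).conj_mem n hn g)
  simpa using h hx

/-- The upper η-series: `η₀ = 1`, and `η_{i+1}/η_i = η(G/η_i)` is the product of all
powerfully embedded subgroups of `G/η_i`. -/
def etaUp (p : ℕ) (G : Type*) [Group G] : ℕ → Subgroup G
  | 0 => ⊥
  | i + 1 => sSup {N : Subgroup G | N.Normal ∧ ⁅N, (⊤ : Subgroup G)⁆ ≤ pPow p N ⊔ etaUp p G i}

instance etaUp_normal (p : ℕ) (G : Type*) [Group G] (i : ℕ) : (etaUp p G i).Normal := by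
  cases i with
  | zero => show (⊥ : Subgroup G).Normal; infer_instance
  | succ i => exact normal_sSup fun N hN => hN.1

/-- The powerful class of `G`. -/
noncomputable def pwc (p : ℕ) (G : Type*) [Group G] : ℕ := sInf {k | etaUp p G k = ⊤}

/-- Iterated commutator `[N, G, G, ..., G]` with `i` copies of `G`. -/
def itComm {G : Type*} [Group G] (N : Subgroup G) : ℕ → Subgroup G
  | 0 => N
  | i + 1 => ⁅itComm N i, (⊤ : Subgroup G)⁆

/-- `N` is PF-embedded in `G`: it admits a potent filtration. -/
def PFEmbedded {G : Type*} [Group G] (p : ℕ) (N : Subgroup G) : Prop :=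
  ∃ (s : ℕ) (M : ℕ → Subgroup G), M 0 = N ∧ M s = ⊥ ∧
    (∀ i, M (i + 1) ≤ M i) ∧ (∀ i, (M i).Normal) ∧
    (∀ i, ⁅M i, (⊤ : Subgroup G)⁆ ≤ M (i + 1)) ∧
    (∀ i, itComm (M i) (p - 1) ≤ pPow p (M (i + 1)))

section

open scoped commutatorElement

/-- A descending series of subgroups with `⁅F i, F j⁆ ≤ F (i + j)`. -/
structure CommSeries (X : Type*) [Group X] where
  /-- The terms of the series. -/
  term : ℕ → Subgroup X
  succ_le : ∀ i, term (i + 1) ≤ term i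
  comm_mem : ∀ {i j x y}, x ∈ term i → y ∈ term j → ⁅x, y⁆ ∈ term (i + j)

namespace CommSeries

variable {X : Type*} [Group X]

theorem conj_mem (F : CommSeries X) {i : ℕ} {c x : X} (hc : c ∈ F.term 0) (hx : x ∈ F.term i) :
    c * x * c⁻¹ ∈ F.term i := by
  have h := F.comm_mem hc hx
  rw [zero_add] at h
  simpa [commutatorElement_def] using mul_mem h hx

theorem le_zero (F : CommSeries X) (i : ℕ) : F.term i ≤ F.term 0 := by
  induction i with
  | zero => exact le_rfl
  | succ i ih => exact (F.succ_le i).trans ih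

theorem conj_mem' (F : CommSeries X) {i : ℕ} {c x : X} (hc : c ∈ F.term 0) (hx : x ∈ F.term i) :
    c⁻¹ * x * c ∈ F.term i := by
  simpa using F.conj_mem (inv_mem hc) hx

/-- The elements of `F i` that an endomorphism fixes modulo `F (i + 1)`. -/
def derive (σ : X →* X) (F : CommSeries X) : CommSeries X where
  term i :=
    { carrier := {f | f ∈ F.term i ∧ f⁻¹ * σ f ∈ F.term (i + 1)}
      one_mem' := ⟨one_mem _, by simp⟩
      mul_mem' := by
        rintro f g ⟨hf, hf'⟩ ⟨hg, hg'⟩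
        refine ⟨mul_mem hf hg, ?_⟩
        have := mul_mem (F.conj_mem' (F.le_zero _ hg) hf') hg'
        simpa [mul_assoc] using this
      inv_mem' := by
        rintro f ⟨hf, hf'⟩
        refine ⟨inv_mem hf, ?_⟩
        have := F.conj_mem (F.le_zero _ hf) (inv_mem hf')
        simpa [mul_assoc] using this }
  succ_le i f hf := ⟨F.succ_le _ hf.1, F.succ_le _ hf.2⟩
  comm_mem := by
    rintro i j f g ⟨hf, hf'⟩ ⟨hg, hg'⟩
    refine ⟨F.comm_mem hf hg, ?_⟩
    have hσg : σ g ∈ F.term j := by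
      simpa using mul_mem hg (F.succ_le _ hg')
    have h1 := F.comm_mem hf' hσg
    have h2 := F.comm_mem hf hg'
    rw [add_right_comm] at h1
    have h3 := F.conj_mem (c := ⁅f, g⁆⁻¹ * f)
      (mul_mem (inv_mem (F.le_zero _ (F.comm_mem hf hg))) (F.le_zero _ hf)) h1
    have h4 := F.conj_mem (F.le_zero _ hg) h2
    have := mul_mem h3 h4
    rw [map_commutatorElement]
    convert this using 1
    simp only [commutatorElement_def]
    group

theorem mem_derive {σ : X →* X} {F : CommSeries X} {i : ℕ} {f : X} :
    f ∈ (F.derive σ).term i ↔ f ∈ F.term i ∧ f⁻¹ * σ f ∈ F.term (i + 1) := Iff.rfl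

theorem mem_derive' {σ : X →* X} {F : CommSeries X} {i : ℕ} {f : X} :
    f ∈ (F.derive σ).term i ↔ f ∈ F.term i ∧ σ f * f⁻¹ ∈ F.term (i + 1) := by
  rw [mem_derive]
  refine and_congr_right fun hf => ⟨fun h => ?_, fun h => ?_⟩
  · simpa [mul_assoc] using F.conj_mem (F.le_zero _ hf) h
  · simpa [mul_assoc] using F.conj_mem' (F.le_zero _ hf) h

variable {G : Type*} [Group G]

/-- The shift on sequences. -/
def shift (G : Type*) [Group G] : (ℕ → G) →* (ℕ → G) where
  toFun f n := f (n + 1)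
  map_one' := rfl
  map_mul' _ _ := rfl

@[simp] theorem shift_apply (f : ℕ → G) (n : ℕ) : shift G f n = f (n + 1) := rfl

/-- The series of sequences with values in the terms of a given series. -/
def seq (F : CommSeries G) : CommSeries (ℕ → G) where
  term i := Subgroup.pi Set.univ fun _ => F.term i
  succ_le i _ hf n hn := F.succ_le i (hf n hn)
  comm_mem hf hg n hn := F.comm_mem (hf n hn) (hg n hn)

/-- Polynomial sequences relative to `F`, truncated after `K` differences. -/
def poly (F : CommSeries G) : ℕ → CommSeries (ℕ → G)
  | 0 => F.seq
  | K + 1 => (F.poly K).derive (shift G)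

theorem mem_poly_zero {F : CommSeries G} {i : ℕ} {f : ℕ → G} :
    f ∈ (F.poly 0).term i ↔ ∀ n, f n ∈ F.term i :=
  ⟨fun h n => h n trivial, fun h n _ => h n⟩

theorem mem_of_mem_poly {F : CommSeries G} {K i : ℕ} {f : ℕ → G} (hf : f ∈ (F.poly K).term i)
    (n : ℕ) : f n ∈ F.term i := by
  induction K with
  | zero => exact mem_poly_zero.1 hf n
  | succ K ih => exact ih hf.1

theorem conj_pow_mem_poly {F : CommSeries G} {a : G}
    (ha : ∀ i, ∀ v ∈ F.term i, v⁻¹ * (a⁻¹ * v * a) ∈ F.term (i + 1)) (K : ℕ) {i : ℕ} {v : G}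
    (hv : v ∈ F.term i) : (fun n : ℕ => (a ^ n)⁻¹ * v * a ^ n) ∈ (F.poly K).term i := by
  induction K generalizing i v with
  | zero =>
    refine mem_poly_zero.2 fun n => ?_
    induction n with
    | zero => simpa using hv
    | succ n ih =>
      have := mul_mem ih (F.succ_le _ (ha _ _ ih))
      simpa [pow_succ, mul_assoc] using this
  | succ K ih =>
    refine ⟨ih hv, ?_⟩
    convert ih (ha _ _ hv) using 1
    ext n
    simp only [Pi.mul_apply, Pi.inv_apply, shift_apply, pow_succ']
    group

theorem pow_mul_pow_mem_poly {F : CommSeries G} {a e : G}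
    (ha : ∀ i, ∀ v ∈ F.term i, v⁻¹ * (a⁻¹ * v * a) ∈ F.term (i + 1)) (he : e ∈ F.term 1) (K : ℕ) :
    (fun n : ℕ => (a ^ n)⁻¹ * (a * e) ^ n) ∈ (F.poly K).term 0 := by
  have key : ∀ n : ℕ, (a ^ (n + 1))⁻¹ * (a * e) ^ (n + 1) * ((a ^ n)⁻¹ * (a * e) ^ n)⁻¹ =
      (a ^ n)⁻¹ * e * a ^ n := fun n => by
    rw [pow_succ' (a * e), pow_succ' a]
    group
  induction K with
  | zero =>
    refine mem_poly_zero.2 fun n => ?_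
    induction n with
    | zero => simp
    | succ n ih =>
      have := mul_mem (F.succ_le _ (mem_of_mem_poly (conj_pow_mem_poly ha 0 he) n)) ih
      rw [← key] at this
      simpa [mul_assoc] using this
  | succ K ih =>
    refine mem_derive'.2 ⟨ih, ?_⟩
    convert conj_pow_mem_poly ha K he using 1
    ext n
    exact key n

theorem pow_choose_mem_poly {F : CommSeries G} (K : ℕ) {i k : ℕ} {v : G}
    (hv : v ∈ F.term (i + k)) : (fun n : ℕ => v ^ n.choose k) ∈ (F.poly K).term i := by
  have anti : Antitone F.term := antitone_nat_of_succ_le F.succ_le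
  induction K generalizing i k with
  | zero => exact mem_poly_zero.2 fun n => pow_mem (anti (Nat.le_add_right i k) hv) _
  | succ K ih =>
    refine ⟨ih hv, ?_⟩
    cases k with
    | zero =>
      convert one_mem ((F.poly K).term (i + 1)) using 1
      ext n
      simp
    | succ k =>
      rw [← add_assoc, add_right_comm] at hv
      convert ih hv using 1
      ext n
      simp [Nat.choose_succ_succ, add_comm (n.choose k), pow_add]

theorem apply_mem_of_mem_poly {F : CommSeries G} {K i k : ℕ} (hk : k ≤ K) {f : ℕ → G}
    (hf : f ∈ (F.poly K).term i) (h1 : ∀ m < k, f m = 1) : f k ∈ F.term (i + k) := by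
  induction k generalizing K i f with
  | zero => exact mem_of_mem_poly hf 0
  | succ k ih =>
    obtain ⟨K, rfl⟩ : ∃ K', K = K' + 1 := ⟨K - 1, by omega⟩
    have := ih (by omega) hf.2 fun m hm => by
      simp [h1 m (by omega), h1 (m + 1) (by omega)]
    simpa [h1 k (by omega), add_assoc, add_comm 1 k] using this

/-- A polynomial sequence vanishing at `0, 1` takes at a prime `p` a value in the subgroup
generated by the `p`-th powers of `F 2` and by `F p`. -/
theorem apply_prime_mem {F : CommSeries G} {p : ℕ} (hp : p.Prime) {k : ℕ} (hk2 : 2 ≤ k)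
    (hkp : k ≤ p) {h : ℕ → G} (hh : h ∈ (F.poly p).term 0) (h1 : ∀ m < k, h m = 1) :
    h p ∈ pPow p (F.term 2) ⊔ F.term p := by
  have anti : Antitone F.term := antitone_nat_of_succ_le F.succ_le
  induction hkp using Nat.decreasingInduction generalizing h with
  | self =>
    have := apply_mem_of_mem_poly le_rfl hh h1
    rw [zero_add] at this
    exact Subgroup.mem_sup_right this
  | of_succ k hkp ih =>
    have hhk := apply_mem_of_mem_poly hkp.le hh h1
    have := ih (by omega) (mul_mem (inv_mem (pow_choose_mem_poly p hhk)) hh) fun m hm => by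
      rcases Nat.lt_succ_iff_lt_or_eq.1 hm with hm | rfl
      · simp [h1 m hm, Nat.choose_eq_zero_of_lt hm]
      · simp
    obtain ⟨c, hc⟩ := hp.dvd_choose_self (by omega) hkp
    have hpow : h k ^ p.choose k ∈ pPow p (F.term 2) := by
      rw [hc, mul_comm, pow_mul]
      exact Subgroup.subset_closure ⟨_, pow_mem (anti (by omega) hhk) c, rfl⟩
    simpa using mul_mem (Subgroup.mem_sup_left hpow) this

end CommSeries

variable {G : Type*} [Group G] {p : ℕ}

theorem Subgroup.commutator_commutator_le_of_rotate {A B C N : Subgroup G} [hN : N.Normal]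
    (h1 : ⁅⁅B, C⁆, A⁆ ≤ N) (h2 : ⁅⁅C, A⁆, B⁆ ≤ N) : ⁅⁅A, B⁆, C⁆ ≤ N := by
  have key : ∀ H : Subgroup G, H ≤ N ↔ H.map (QuotientGroup.mk' N) = ⊥ := fun H => by
    rw [Subgroup.map_eq_bot_iff, QuotientGroup.ker_mk']
  simp only [key, Subgroup.map_commutator] at *
  exact Subgroup.commutator_commutator_eq_bot_of_rotate h1 h2

theorem Subgroup.commutator_top_le_self (N : Subgroup G) [N.Normal] :
    ⁅N, (⊤ : Subgroup G)⁆ ≤ N :=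
  Subgroup.commutator_le_left _ _

theorem Subgroup.commutator_closure_top_le {S : Set G} {N : Subgroup G} [hN : N.Normal]
    (h : ∀ s ∈ S, ∀ g, ⁅s, g⁆ ∈ N) : ⁅Subgroup.closure S, (⊤ : Subgroup G)⁆ ≤ N := by
  rw [Subgroup.commutator_le]
  intro x hx g _
  induction hx using Subgroup.closure_induction with
  | mem s hs => exact h s hs g
  | one => simp
  | mul x y _ _ hx hy =>
    rw [commutatorElement_mul_left_eq_conj_mul]
    exact mul_mem (hN.conj_mem _ hy _) hx
  | inv x _ hx =>
    rw [commutatorElement_inv_left, ← commutatorElement_inv]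
    simpa using hN.conj_mem _ (inv_mem hx) x⁻¹

theorem pow_mem_pPow {N : Subgroup G} {x : G} (hx : x ∈ N) : x ^ p ∈ pPow p N :=
  Subgroup.subset_closure ⟨x, hx, rfl⟩

theorem pPow_mono {M N : Subgroup G} (h : M ≤ N) : pPow p M ≤ pPow p N :=
  Subgroup.closure_mono (Set.image_mono h)

theorem pPow_le {M N : Subgroup G} : pPow p M ≤ N ↔ ∀ x ∈ M, x ^ p ∈ N := by
  simp [pPow, Subgroup.closure_le, Set.subset_def]

theorem pPow_le_self (N : Subgroup G) : pPow p N ≤ N :=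
  pPow_le.2 fun _ hx => pow_mem hx _

instance pPow.instNormal (N : Subgroup G) [hN : N.Normal] : (pPow p N).Normal :=
  pPow_normal p hN

instance itComm_normal (N : Subgroup G) [N.Normal] (i : ℕ) : (itComm N i).Normal := by
  induction i with
  | zero => assumption
  | succ i ih => exact Subgroup.commutator_normal _ _

theorem itComm_mono {M N : Subgroup G} (h : M ≤ N) (i : ℕ) : itComm M i ≤ itComm N i := by
  induction i with
  | zero => exact h
  | succ i ih => exact Subgroup.commutator_mono ih le_rfl

theorem itComm_succ' (N : Subgroup G) (i : ℕ) :
    itComm N (i + 1) = itComm ⁅N, (⊤ : Subgroup G)⁆ i := by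
  induction i with
  | zero => rfl
  | succ i ih => exact congrArg (⁅·, (⊤ : Subgroup G)⁆) ih

theorem itComm_add (N : Subgroup G) (i j : ℕ) : itComm N (i + j) = itComm (itComm N i) j := by
  induction j with
  | zero => rfl
  | succ j ih => exact congrArg (⁅·, (⊤ : Subgroup G)⁆) ih

theorem commutator_itComm_le (N : Subgroup G) [N.Normal] (i j : ℕ) :
    ⁅itComm N i, itComm N j⁆ ≤ itComm N (i + j + 1) := by
  induction j generalizing i with
  | zero => exact Subgroup.commutator_mono le_rfl le_top
  | succ j ih =>
    rw [Subgroup.commutator_comm]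
    refine Subgroup.commutator_commutator_le_of_rotate (A := itComm N j) (B := ⊤) ?_ ?_
    · rw [Subgroup.commutator_comm ⊤]
      refine (ih (i + 1)).trans (le_of_eq ?_)
      congr 1
      omega
    · exact Subgroup.commutator_mono (ih i) le_rfl

/-- The series `N, N, ⁅N, G⁆, ⁅N, G, G⁆, …`. -/
def itCommSeries (N : Subgroup G) [N.Normal] : CommSeries G where
  term i := itComm N (i - 1)
  succ_le i := by
    cases i with
    | zero => exact le_rfl
    | succ i => exact Subgroup.commutator_top_le_self (itComm N i)
  comm_mem := by
    intro i j x y hx hy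
    rcases i with - | i
    · rw [zero_add]
      exact Subgroup.commutator_le_right (itComm N 0) _ (Subgroup.commutator_mem_commutator hx hy)
    rcases j with - | j
    · exact Subgroup.commutator_le_left _ (itComm N 0) (Subgroup.commutator_mem_commutator hx hy)
    convert commutator_itComm_le N i j (Subgroup.commutator_mem_commutator hx hy) using 2
    omega

/-- A relative form of the Hall–Petrescu formula. -/
theorem hall_pow (hp : p.Prime) {E : Subgroup G} [hE : E.Normal] (a : G) {e : G} (he : e ∈ E) :
    (e ^ p)⁻¹ * ((a ^ p)⁻¹ * (a * e) ^ p) ∈ pPow p ⁅E, (⊤ : Subgroup G)⁆ ⊔ itComm E (p - 1) := by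
  have hcomm : ∀ i, ∀ v ∈ (itCommSeries E).term i,
      v⁻¹ * (a⁻¹ * v * a) ∈ (itCommSeries E).term (i + 1) := by
    intro i v hv
    have hv' : ⁅v⁻¹, a⁻¹⁆ ∈ itComm E (i - 1 + 1) :=
      Subgroup.commutator_mem_commutator (inv_mem hv) trivial
    have : v⁻¹ * (a⁻¹ * v * a) = ⁅v⁻¹, a⁻¹⁆ := by
      simp [commutatorElement_def, mul_assoc]
    rw [this]
    cases i with
    | zero => exact Subgroup.commutator_top_le_self E hv'
    | succ i => exact hv'
  have h1 := CommSeries.pow_mul_pow_mem_poly hcomm (show e ∈ (itCommSeries E).term 1 from he) p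
  have h2 := CommSeries.pow_choose_mem_poly (F := itCommSeries E) p (i := 0) (k := 1)
    (show e ∈ (itCommSeries E).term (0 + 1) from he)
  have := CommSeries.apply_prime_mem hp le_rfl hp.two_le (mul_mem (inv_mem h2) h1) fun m hm => by
    interval_cases m <;> simp
  simp only [Pi.mul_apply, Pi.inv_apply, Nat.choose_one_right] at this
  exact this

theorem commutatorElement_pow_left (hp : p.Prime) {N : Subgroup G} [N.Normal] {x : G} (hx : x ∈ N)
    (g : G) : (⁅x, g⁆ ^ p)⁻¹ * ⁅x ^ p, g⁆ ∈
      pPow p ⁅⁅N, (⊤ : Subgroup G)⁆, (⊤ : Subgroup G)⁆ ⊔ itComm ⁅N, (⊤ : Subgroup G)⁆ (p - 1) := by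
  convert hall_pow hp x⁻¹ (Subgroup.commutator_mem_commutator hx (Subgroup.mem_top g)) using 2
  have : x⁻¹ * ⁅x, g⁆ = g * x⁻¹ * g⁻¹ := by simp [commutatorElement_def, mul_assoc]
  rw [this, conj_pow]
  simp [commutatorElement_def, mul_assoc]

/-- A descending central series of normal subgroups with `⁅M i, G, …, G⁆ ≤ (M (i + 1)) ^ p`. -/
structure IsPotentFiltration (p : ℕ) (M : ℕ → Subgroup G) : Prop where
  normal : ∀ i, (M i).Normal
  succ_le : ∀ i, M (i + 1) ≤ M i
  central : ∀ i, ⁅M i, (⊤ : Subgroup G)⁆ ≤ M (i + 1)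
  potent : ∀ i, itComm (M i) (p - 1) ≤ pPow p (M (i + 1))
  eventually_bot : ∃ s, M s = ⊥

namespace IsPotentFiltration

variable {M : ℕ → Subgroup G}

theorem le_bot_induction (hM : IsPotentFiltration p M) {P : ℕ → Prop}
    (bot : ∀ i, M i = ⊥ → P i) (step : ∀ i, P (i + 1) → P i) (i : ℕ) : P i := by
  obtain ⟨s, hs⟩ := hM.eventually_bot
  rcases le_total i s with h | h
  · induction h using Nat.decreasingInduction with
    | self => exact bot _ hs
    | of_succ k _ ih => exact step k ih
  · exact bot i (eq_bot_iff.2 (hs ▸ antitone_nat_of_succ_le hM.succ_le h))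

theorem commutator_pPow_le (hp : p.Prime) (hM : IsPotentFiltration p M) (i : ℕ) :
    ⁅pPow p (M i), (⊤ : Subgroup G)⁆ ≤ pPow p ⁅M i, (⊤ : Subgroup G)⁆ := by
  have := hM.normal
  refine hM.le_bot_induction (P := fun i => ⁅pPow p (M i), (⊤ : Subgroup G)⁆ ≤
    pPow p ⁅M i, (⊤ : Subgroup G)⁆) (fun i hi => ?_) (fun i ih => ?_) i
  · have : pPow p (M i) = ⊥ := eq_bot_iff.2 ((pPow_le_self _).trans hi.le)
    rw [this, Subgroup.commutator_bot_left]
    exact bot_le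
  · refine Subgroup.commutator_closure_top_le ?_
    rintro - ⟨x, hx, rfl⟩ g
    have hW : pPow p ⁅⁅M i, (⊤ : Subgroup G)⁆, (⊤ : Subgroup G)⁆ ⊔
        itComm ⁅M i, (⊤ : Subgroup G)⁆ (p - 1) ≤ pPow p ⁅M i, (⊤ : Subgroup G)⁆ := by
      refine sup_le (pPow_mono (Subgroup.commutator_top_le_self _)) ?_
      rw [← itComm_succ']
      exact (Subgroup.commutator_mono (hM.potent i) le_rfl).trans
        (ih.trans (pPow_mono (Subgroup.commutator_mono (hM.succ_le i) le_rfl)))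
    have h1 := hW (commutatorElement_pow_left hp hx g)
    have h2 : ⁅x, g⁆ ^ p ∈ pPow p ⁅M i, (⊤ : Subgroup G)⁆ :=
      pow_mem_pPow (Subgroup.commutator_mem_commutator hx trivial)
    simpa using mul_mem h2 h1

theorem map_commutator (hp : p.Prime) (hM : IsPotentFiltration p M) :
    IsPotentFiltration p fun i => ⁅M i, (⊤ : Subgroup G)⁆ where
  normal i := have := hM.normal i; inferInstance
  succ_le i := Subgroup.commutator_mono (hM.succ_le i) le_rfl
  central i := Subgroup.commutator_mono (hM.central i) le_rfl
  potent i := by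
    rw [← itComm_succ']
    exact (Subgroup.commutator_mono (hM.potent i) le_rfl).trans (hM.commutator_pPow_le hp _)
  eventually_bot := hM.eventually_bot.imp fun _ hs => by
    rw [hs, Subgroup.commutator_bot_left]

theorem map_itComm (hp : p.Prime) (hM : IsPotentFiltration p M) (j : ℕ) :
    IsPotentFiltration p fun i => itComm (M i) j := by
  induction j with
  | zero => exact hM
  | succ j ih => exact ih.map_commutator hp

theorem itComm_pPow_le (hp : p.Prime) (hM : IsPotentFiltration p M) (i j : ℕ) :
    itComm (pPow p (M i)) j ≤ pPow p (itComm (M i) j) := by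
  induction j with
  | zero => exact le_rfl
  | succ j ih =>
    exact (Subgroup.commutator_mono ih le_rfl).trans ((hM.map_itComm hp j).commutator_pPow_le hp i)

theorem map_pPow (hp : p.Prime) (hM : IsPotentFiltration p M) :
    IsPotentFiltration p fun i => pPow p (M i) where
  normal i := pPow_normal p (hM.normal i)
  succ_le i := pPow_mono (hM.succ_le i)
  central i := (hM.commutator_pPow_le hp i).trans (pPow_mono (hM.central i))
  potent i := (hM.itComm_pPow_le hp i _).trans (pPow_mono (hM.potent i))
  eventually_bot := hM.eventually_bot.imp fun _ hs =>
    eq_bot_iff.2 ((pPow_le_self _).trans hs.le)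

theorem map_iterate_pPow (hp : p.Prime) (hM : IsPotentFiltration p M) (k : ℕ) :
    IsPotentFiltration p fun i => (pPow p)^[k] (M i) := by
  induction k with
  | zero => exact hM
  | succ k ih => simpa only [Function.iterate_succ_apply'] using ih.map_pPow hp

theorem mul_pow_prime (hp : p.Prime) (hM : IsPotentFiltration p M) (a : G) {i : ℕ} {e : G}
    (he : e ∈ M i) : (a ^ p * e ^ p)⁻¹ * (a * e) ^ p ∈ pPow p (M (i + 1)) := by
  have := hM.normal i
  rw [mul_inv_rev, mul_assoc]
  exact sup_le (pPow_mono (hM.central i)) (hM.potent i) (hall_pow hp a he)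

theorem pPow_commutator_le (hp : p.Prime) (hM : IsPotentFiltration p M) (i : ℕ) :
    pPow p ⁅M i, (⊤ : Subgroup G)⁆ ≤ ⁅pPow p (M i), (⊤ : Subgroup G)⁆ := by
  have := hM.normal
  have hC := hM.map_commutator hp
  refine hM.le_bot_induction (P := fun i => pPow p ⁅M i, (⊤ : Subgroup G)⁆ ≤
    ⁅pPow p (M i), (⊤ : Subgroup G)⁆) (fun i hi => ?_) (fun i ih => ?_) i
  · rw [hi, Subgroup.commutator_bot_left]
    exact (pPow_le_self _).trans bot_le
  · replace ih := ih.trans (Subgroup.commutator_mono (pPow_mono (hM.succ_le i)) le_rfl)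
    rw [pPow_le]
    intro x hx
    rw [Subgroup.commutator_def] at hx
    induction hx using Subgroup.closure_induction with
    | mem _ hx =>
      obtain ⟨x, hx, g, -, rfl⟩ := hx
      have h1 := sup_le (pPow_mono (hC.central i)) (hC.potent i)
        (commutatorElement_pow_left hp hx g)
      have h2 : ⁅x ^ p, g⁆ ∈ ⁅pPow p (M i), (⊤ : Subgroup G)⁆ :=
        Subgroup.commutator_mem_commutator (pow_mem_pPow hx) trivial
      exact inv_mem_iff.1 ((Subgroup.mul_mem_cancel_right _ h2).1 (ih h1))
    | one => simp
    | mul x y hx' hy' hx hy =>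
      rw [← Subgroup.commutator_def] at hx' hy'
      exact (Subgroup.mul_mem_cancel_left _ (inv_mem (mul_mem hx hy))).1
        (ih (hC.mul_pow_prime hp x hy'))
    | inv x _ hx => simpa using hx

theorem pow_iterate_mem {N : Subgroup G} {x : G} (hx : x ∈ N) (k : ℕ) :
    x ^ p ^ k ∈ (pPow p)^[k] N := by
  induction k with
  | zero => simpa using hx
  | succ k ih =>
    rw [Function.iterate_succ_apply', pow_succ, pow_mul]
    exact pow_mem_pPow ih

theorem mul_pow_prime' (hp : p.Prime) (hM : IsPotentFiltration p M) (a : G) {i : ℕ} {e : G}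
    (he : e ∈ M i) : (a ^ p)⁻¹ * (a * e) ^ p ∈ pPow p (M i) := by
  have := mul_mem (pow_mem_pPow he) (pPow_mono (hM.succ_le i) (hM.mul_pow_prime hp a he))
  simpa [mul_assoc] using this

theorem mul_pow_iterate (hp : p.Prime) (hM : IsPotentFiltration p M) (a : G) {i : ℕ} {e : G}
    (he : e ∈ M i) (k : ℕ) :
    (a ^ p ^ k * e ^ p ^ k)⁻¹ * (a * e) ^ p ^ k ∈ (pPow p)^[k] (M (i + 1)) := by
  induction k with
  | zero => simp
  | succ k ih =>
    have hMk := hM.map_iterate_pPow hp k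
    have h1 := hMk.mul_pow_prime hp (a ^ p ^ k) (pow_iterate_mem he k)
    have h2 := hMk.mul_pow_prime' hp (a ^ p ^ k * e ^ p ^ k) ih
    simp only [Function.iterate_succ_apply', pow_succ, pow_mul]
    simpa [mul_assoc] using mul_mem h1 h2

theorem exists_pow_iterate (hp : p.Prime) (hM : IsPotentFiltration p M) {i : ℕ} (k : ℕ) {y : G}
    (hy : y ∈ (pPow p)^[k] (M i)) :
    ∃ x ∈ M i, (x ^ p ^ k)⁻¹ * y ∈ (pPow p)^[k] (M (i + 1)) := by
  induction k generalizing y with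
  | zero => exact ⟨y, hy, by simp⟩
  | succ k ih =>
    have hMk := hM.map_iterate_pPow hp k
    have hN : ((pPow p)^[k + 1] (M (i + 1))).Normal := (hM.map_iterate_pPow hp (k + 1)).normal _
    rw [Function.iterate_succ_apply'] at hy
    induction hy using Subgroup.closure_induction with
    | mem _ hy =>
      obtain ⟨y, hy, rfl⟩ := hy
      obtain ⟨x, hx, hxy⟩ := ih hy
      refine ⟨x, hx, ?_⟩
      have := hMk.mul_pow_prime' hp (x ^ p ^ k) hxy
      rw [mul_inv_cancel_left, ← pow_mul, ← pow_succ] at this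
      rwa [Function.iterate_succ_apply']
    | one => exact ⟨1, one_mem _, by simp⟩
    | mul y y' _ _ hy hy' =>
      obtain ⟨x, hx, hxy⟩ := hy
      obtain ⟨x', hx', hxy'⟩ := hy'
      refine ⟨x * x', mul_mem hx hx', ?_⟩
      have h := hM.mul_pow_iterate hp x hx' (k + 1)
      rw [← QuotientGroup.eq] at hxy hxy' h ⊢
      rw [← h, QuotientGroup.mk_mul, QuotientGroup.mk_mul, hxy, hxy']
    | inv y _ hy =>
      obtain ⟨x, hx, hxy⟩ := hy
      refine ⟨x⁻¹, inv_mem hx, ?_⟩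
      rw [← QuotientGroup.eq] at hxy ⊢
      rw [inv_pow, QuotientGroup.mk_inv, QuotientGroup.mk_inv, hxy]

theorem commutator_iterate_pPow_eq (hp : p.Prime) (hM : IsPotentFiltration p M) (i k : ℕ) :
    ⁅(pPow p)^[k] (M i), (⊤ : Subgroup G)⁆ = (pPow p)^[k] ⁅M i, (⊤ : Subgroup G)⁆ := by
  induction k with
  | zero => rfl
  | succ k ih =>
    have hMk := hM.map_iterate_pPow hp k
    simp only [Function.iterate_succ_apply', ← ih]
    exact le_antisymm (hMk.commutator_pPow_le hp i) (hMk.pPow_commutator_le hp i)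

theorem commutatorElement_pow_iterate_left (hp : p.Prime) (hM : IsPotentFiltration p M) {i : ℕ}
    {x : G} (hx : x ∈ M i) (g : G) (k : ℕ) :
    (⁅x, g⁆ ^ p ^ k)⁻¹ * ⁅x ^ p ^ k, g⁆ ∈ (pPow p)^[k] ⁅M (i + 1), (⊤ : Subgroup G)⁆ := by
  induction k with
  | zero => simp only [pow_zero, pow_one, inv_mul_cancel, one_mem]
  | succ k ih =>
    have hMk := hM.map_iterate_pPow hp k
    have := hMk.normal i
    have hC := hMk.map_commutator hp
    have h1 := sup_le (pPow_mono (hC.central i)) (hC.potent i)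
      (commutatorElement_pow_left hp (pow_iterate_mem hx k) g)
    have h2 := ((hM.map_commutator hp).map_iterate_pPow hp k).mul_pow_prime' hp (⁅x, g⁆ ^ p ^ k) ih
    rw [mul_inv_cancel_left] at h2
    rw [hM.commutator_iterate_pPow_eq hp] at h1
    simp only [Function.iterate_succ_apply', pow_succ, pow_mul]
    simpa [mul_assoc] using mul_mem h2 h1

theorem commutatorElement_pow_right (hp : p.Prime) (hM : IsPotentFiltration p M) {i : ℕ} {x h : G}
    (hxh : ⁅x, h⁆ ∈ M i) : (⁅x, h⁆ ^ p)⁻¹ * ⁅x, h ^ p⁆ ∈ pPow p (M (i + 1)) := by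
  have hN := pPow_normal p (hM.normal (i + 1))
  have h1 := hM.mul_pow_prime hp h⁻¹ (inv_mem hxh)
  have h2 : h⁻¹ * ⁅x, h⁆⁻¹ = x * h⁻¹ * x⁻¹ := by simp [commutatorElement_def, mul_assoc]
  rw [h2, conj_pow, ← QuotientGroup.eq] at h1
  rw [← QuotientGroup.eq]
  generalize ⁅x, h⁆ = u at h1
  have := congrArg (fun z => z⁻¹ * ((h ^ p : G) : G ⧸ pPow p (M (i + 1)))⁻¹) h1
  simpa [commutatorElement_def, mul_assoc] using this

theorem commutatorElement_pow_iterate_right (hp : p.Prime) (hM : IsPotentFiltration p M) {i : ℕ}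
    {x : G} (hx : x ∈ M i) (g : G) (k : ℕ) :
    (⁅x, g⁆ ^ p ^ k)⁻¹ * ⁅x, g ^ p ^ k⁆ ∈ (pPow p)^[k] ⁅M (i + 1), (⊤ : Subgroup G)⁆ := by
  induction k with
  | zero => simp only [pow_zero, pow_one, inv_mul_cancel, one_mem]
  | succ k ih =>
    have hC := hM.map_commutator hp
    have hCk := hC.map_iterate_pPow hp k
    have hmem : ⁅x, g ^ p ^ k⁆ ∈ (pPow p)^[k] ⁅M i, (⊤ : Subgroup G)⁆ :=
      (Subgroup.mul_mem_cancel_left _ (inv_mem (pow_iterate_mem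
        (Subgroup.commutator_mem_commutator hx (Subgroup.mem_top g)) k))).1 (hCk.succ_le i ih)
    have h1 := hCk.commutatorElement_pow_right hp hmem
    have h2 := hCk.mul_pow_prime' hp (⁅x, g⁆ ^ p ^ k) ih
    rw [mul_inv_cancel_left] at h2
    simp only [Function.iterate_succ_apply', pow_succ, pow_mul]
    simpa [mul_assoc] using mul_mem h2 h1

theorem commutatorElement_pow_iterate_comm (hp : p.Prime) (hM : IsPotentFiltration p M) {i : ℕ}
    {x : G} (hx : x ∈ M i) (g : G) (k : ℕ) :
    ⁅x ^ p ^ k, g⁆⁻¹ * ⁅x, g ^ p ^ k⁆ ∈ ⁅(pPow p)^[k] (M (i + 1)), (⊤ : Subgroup G)⁆ := by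
  rw [hM.commutator_iterate_pPow_eq hp]
  have h1 := hM.commutatorElement_pow_iterate_left hp hx g k
  have h2 := hM.commutatorElement_pow_iterate_right hp hx g k
  have := mul_mem (inv_mem h1) h2
  rwa [mul_inv_rev, inv_inv, mul_assoc, mul_inv_cancel_left] at this

end IsPotentFiltration

theorem Subgroup.commutator_sup_top_le {A B N : Subgroup G} [N.Normal]
    (hA : ⁅A, (⊤ : Subgroup G)⁆ ≤ N) (hB : ⁅B, (⊤ : Subgroup G)⁆ ≤ N) :
    ⁅A ⊔ B, (⊤ : Subgroup G)⁆ ≤ N := by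
  rw [Subgroup.sup_eq_closure]
  refine Subgroup.commutator_closure_top_le ?_
  rintro s (hs | hs) g
  · exact hA (Subgroup.commutator_mem_commutator hs trivial)
  · exact hB (Subgroup.commutator_mem_commutator hs trivial)

theorem commutatorElement_mem_iff {N : Subgroup G} [N.Normal] {a b : G} :
    ⁅a, b⁆ ∈ N ↔ Commute (a : G ⧸ N) b := by
  rw [← QuotientGroup.eq_one_iff, ← commutatorElement_eq_one_iff_commute]
  rfl

theorem itComm_top (j : ℕ) : itComm (⊤ : Subgroup G) j = (⊤ : Subgroup G).lowerCentralSeries j := by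
  induction j with
  | zero => rfl
  | succ j ih => exact congrArg (⁅·, (⊤ : Subgroup G)⁆) ih

theorem le_of_le_commutator_sup [Group.IsNilpotent G] {A N : Subgroup G} [A.Normal] [N.Normal]
    (h : A ≤ ⁅A, (⊤ : Subgroup G)⁆ ⊔ N) : A ≤ N := by
  have key : ∀ j, A ≤ itComm A j ⊔ N := fun j => by
    induction j with
    | zero => exact le_sup_left
    | succ j ih =>
      refine h.trans (sup_le ?_ le_sup_right)
      exact (Subgroup.commutator_mono ih le_rfl).trans (Subgroup.commutator_sup_top_le
        (le_sup_left (a := itComm A (j + 1)))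
        ((Subgroup.commutator_top_le_self N).trans le_sup_right))
  have h2 := key (Group.nilpotencyClass G)
  have h3 : itComm A (Group.nilpotencyClass G) ≤ ⊥ := by
    rw [← Subgroup.lowerCentralSeries_nilpotencyClass (G := G), ← itComm_top]
    exact itComm_mono le_top _
  exact h2.trans (sup_le (h3.trans bot_le) le_rfl)

/-- Nakayama's lemma for normal subgroups of a finite `p`-group. -/
theorem le_of_le_frattini_sup [Finite G] [Group.IsNilpotent G] (hG : IsPGroup p G)
    {A N : Subgroup G} [A.Normal] [N.Normal]
    (h : A ≤ ⁅A, (⊤ : Subgroup G)⁆ ⊔ pPow p A ⊔ N) : A ≤ N := by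
  refine le_of_le_commutator_sup ?_
  set B := ⁅A, (⊤ : Subgroup G)⁆ ⊔ N with hB
  replace h : A ≤ pPow p A ⊔ B := h.trans (by rw [hB]; exact le_of_eq (by ac_rfl))
  obtain ⟨e, he⟩ := isPGroup_iff_exists_pow_pow_eq_one.1 hG
  have key : ∀ j ≤ e, ∀ a ∈ A, a ^ p ^ j ∈ B := by
    intro j hj
    induction hj using Nat.decreasingInduction with
    | self => intro a _; simp [he]
    | of_succ j _ ih =>
      intro a ha
      have hcomm : ∀ x ∈ A, ∀ g : G, Commute (x : G ⧸ B) g := fun x hx g =>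
        commutatorElement_mem_iff.1
          (le_sup_left (a := ⁅A, (⊤ : Subgroup G)⁆)
            (Subgroup.commutator_mem_commutator hx (Subgroup.mem_top g)))
      have hs : ∀ z ∈ pPow p A, (z : G ⧸ B) ^ p ^ j = 1 := fun z hz => by
        induction hz using Subgroup.closure_induction with
        | mem z hz =>
          obtain ⟨x, hx, rfl⟩ := hz
          have := ih x hx
          rwa [pow_succ', pow_mul, ← QuotientGroup.eq_one_iff] at this
        | one => simp
        | mul x y hx _ ihx ihy =>
          rw [QuotientGroup.mk_mul, (hcomm x (pPow_le_self A hx) y).mul_pow, ihx, ihy, one_mul]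
        | inv x _ ihx => rw [QuotientGroup.mk_inv, inv_pow, ihx, inv_one]
      obtain ⟨z, hz, b, hb, rfl⟩ := Subgroup.mem_sup_of_normal_right.1 (h ha)
      rw [← QuotientGroup.eq_one_iff, QuotientGroup.mk_pow, QuotientGroup.mk_mul,
        (QuotientGroup.eq_one_iff b).2 hb, mul_one, hs z hz]
  exact fun a ha => by simpa using key 0 (Nat.zero_le _) a ha

theorem mul_card_le_of_lt [Finite G] (hp : p.Prime) (hG : IsPGroup p G) {H K : Subgroup G}
    (h : H < K) : p * Nat.card H ≤ Nat.card K := by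
  have := Fact.mk hp
  obtain ⟨a, ha⟩ := IsPGroup.iff_card.1 (hG.to_subgroup H)
  obtain ⟨b, hb⟩ := IsPGroup.iff_card.1 (hG.to_subgroup K)
  have hlt : Nat.card H < Nat.card K :=
    (Subgroup.card_le_of_le h.le).lt_of_ne fun he => h.ne (Subgroup.eq_of_le_of_card_ge h.le he.ge)
  rw [ha, hb] at *
  rw [← pow_succ']
  exact Nat.pow_le_pow_right hp.pos ((Nat.pow_lt_pow_iff_right hp.one_lt).1 hlt)

theorem le_of_card_lt [Finite G] (hp : p.Prime) (hG : IsPGroup p G) {L T H : Subgroup G}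
    (hcard : Nat.card L < p ^ 2 * Nat.card T) (hTL : T ≤ L) (hTH : T ≤ H) {y : G}
    (hyL : y ∈ L) (hyH : y ∈ H) (hyT : y ∉ T) : L ≤ H := by
  by_contra hLH
  have h1 : T < H ⊓ L := lt_of_le_of_ne (le_inf hTH hTL) fun he => hyT (he ▸ ⟨hyH, hyL⟩)
  have h2 : H ⊓ L < L := lt_of_le_of_ne inf_le_right fun he => hLH (inf_eq_right.1 he)
  have h3 := mul_card_le_of_lt hp hG h1
  have h4 := mul_card_le_of_lt hp hG h2
  have h5 := (Nat.mul_le_mul_left p h3).trans h4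
  rw [← mul_assoc, ← sq] at h5
  exact absurd hcard h5.not_gt

namespace IsPotentFiltration

variable {M : ℕ → Subgroup G}

theorem commutator_eq_bot_of_card_lt [Finite G] [Group.IsNilpotent G] (hp : p.Prime)
    (hG : IsPGroup p G) (hM : IsPotentFiltration p M) (hM0 : M 0 = ⊤) {k : ℕ} {L : Subgroup G}
    (hL : (pPow p)^[k] ⊤ = L)
    (hcard : Nat.card L < p ^ 2 * Nat.card (⁅L, (⊤ : Subgroup G)⁆ ⊔ pPow p L : Subgroup G)) :
    ⁅L, (⊤ : Subgroup G)⁆ = ⊥ := by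
  have hMk := hM.map_iterate_pPow hp k
  have hnorm := hMk.normal
  have hLM : (pPow p)^[k] (M 0) = L := by rw [hM0, hL]
  have hLn : L.Normal := hLM ▸ hnorm 0
  set T := ⁅L, (⊤ : Subgroup G)⁆ ⊔ pPow p L with hT
  have hTL : T ≤ L := sup_le (Subgroup.commutator_top_le_self L) (pPow_le_self L)
  by_cases hLbot : L = ⊥
  · rw [hLbot, Subgroup.commutator_bot_left]
  obtain ⟨i, hi, hi'⟩ : ∃ i, L ≤ (pPow p)^[k] (M i) ∧ ¬ L ≤ (pPow p)^[k] (M (i + 1)) := by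
    by_contra! hcon
    obtain ⟨s, hs⟩ := hMk.eventually_bot
    have : ∀ i, L ≤ (pPow p)^[k] (M i) := fun i => by
      induction i with
      | zero => exact hLM.ge
      | succ i ih => exact hcon i ih
    exact hLbot (eq_bot_iff.2 ((this s).trans hs.le))
  have hle : ∀ j, (pPow p)^[k] (M j) ≤ L := fun j => by
    induction j with
    | zero => exact hLM.le
    | succ j ih => exact (hMk.succ_le j).trans ih
  have hnak : ¬ L ≤ T ⊔ (pPow p)^[k] (M (i + 1)) := fun h => hi' (le_of_le_frattini_sup hG h)
  obtain ⟨x, hxM, hxT⟩ : ∃ x ∈ M i, x ^ p ^ k ∉ T := by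
    by_contra! hcon
    refine hnak fun y hy => ?_
    obtain ⟨x, hx, hxy⟩ := hM.exists_pow_iterate hp k (hi hy)
    have := Subgroup.mul_mem_sup (hcon x hx) hxy
    rwa [mul_inv_cancel_left] at this
  have hgen : ∀ H : Subgroup G, T ≤ H → x ^ p ^ k ∈ H → L ≤ H := fun H hTH hyH =>
    le_of_card_lt hp hG hcard hTL hTH (hle i (pow_iterate_mem hxM k)) hyH hxT
  have hMT : (pPow p)^[k] (M (i + 1)) ≤ T := fun z hz => by
    by_contra hzT
    exact hnak (le_of_card_lt hp hG hcard hTL le_sup_left (hle _ hz)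
      (le_sup_right (a := T) hz) hzT)
  set R := ⁅T, (⊤ : Subgroup G)⁆ with hR
  have hLC : ∀ h ∈ L, ⁅x, h⁆ ∈ R := by
    have := hgen ((Subgroup.centralizer {(x : G ⧸ R)}).comap (QuotientGroup.mk' R)) ?_ ?_
    · intro h hh
      exact commutatorElement_mem_iff.2 (Subgroup.mem_centralizer_singleton_iff.1 (this hh)).symm
    · intro t ht
      have : Commute (t : G ⧸ R) x := commutatorElement_mem_iff.1
        (Subgroup.commutator_mem_commutator ht (Subgroup.mem_top x))
      exact Subgroup.mem_centralizer_singleton_iff.2 this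
    · exact Subgroup.mem_centralizer_singleton_iff.2 ((Commute.refl (x : G ⧸ R)).pow_left _)
  have hLR : ⁅L, (⊤ : Subgroup G)⁆ ≤ R := by
    have := hgen ((Subgroup.center (G ⧸ R)).comap (QuotientGroup.mk' R)) ?_ ?_
    · rw [Subgroup.commutator_le]
      intro l hl g _
      exact commutatorElement_mem_iff.2 (Subgroup.mem_center_iff.1 (this hl) g).symm
    · intro t ht
      refine Subgroup.mem_center_iff.2 fun q => ?_
      obtain ⟨g, rfl⟩ := QuotientGroup.mk_surjective q
      exact (commutatorElement_mem_iff.1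
        (Subgroup.commutator_mem_commutator ht (Subgroup.mem_top g)) : Commute (t : G ⧸ R) g).symm
    · refine Subgroup.mem_center_iff.2 fun q => ?_
      obtain ⟨g, rfl⟩ := QuotientGroup.mk_surjective q
      have h1 := Subgroup.commutator_mono hMT le_rfl
        (hM.commutatorElement_pow_iterate_comm hp hxM g k)
      have h2 := hLC (g ^ p ^ k) (hL ▸ pow_iterate_mem (Subgroup.mem_top g) k)
      have h3 := (Subgroup.mul_mem_cancel_right _ h2).1 h1
      exact (commutatorElement_mem_iff.1 (inv_mem_iff.1 h3) :
        Commute ((x ^ p ^ k : G) : G ⧸ R) g).symm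
  refine eq_bot_iff.2 (le_of_le_frattini_sup hG ((hLR.trans ?_).trans le_sup_left))
  refine Subgroup.commutator_sup_top_le le_sup_left
    (le_trans ?_ le_sup_right)
  have := hMk.commutator_pPow_le hp 0
  rwa [hLM] at this

end IsPotentFiltration

theorem exists_itComm_le_pPow [Finite G] [Group.IsNilpotent G] (hp : p.Prime) (hG : IsPGroup p G)
    {L : Subgroup G} [L.Normal]
    (hcard : p ^ 2 * Nat.card (⁅L, (⊤ : Subgroup G)⁆ ⊔ pPow p L : Subgroup G) ≤ Nat.card L) :
    ∃ d, itComm L d ≤ pPow p L ∧ Nat.card L = p ^ (d + 1) * Nat.card (pPow p L) := by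
  have := Fact.mk hp
  obtain ⟨a, ha⟩ := IsPGroup.iff_card.1 (hG.to_subgroup L)
  obtain ⟨b, hb⟩ := IsPGroup.iff_card.1 (hG.to_subgroup (pPow p L))
  have key : ∀ j, itComm L (j + 1) ≤ pPow p L ∨
      p ^ (j + 2) * Nat.card (itComm L (j + 1) ⊔ pPow p L : Subgroup G) ≤ Nat.card L := fun j => by
    induction j with
    | zero => exact Or.inr hcard
    | succ j ih =>
      refine or_iff_not_imp_left.2 fun hj => ?_
      have hj' : ¬ itComm L (j + 1) ≤ pPow p L :=
        fun h => hj ((Subgroup.commutator_top_le_self (itComm L (j + 1))).trans h)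
      have hlt : itComm L (j + 2) ⊔ pPow p L < itComm L (j + 1) ⊔ pPow p L :=
        lt_of_le_of_ne
          (sup_le_sup_right (Subgroup.commutator_top_le_self (itComm L (j + 1))) _)
          fun he => hj' (le_of_le_commutator_sup (le_sup_left.trans he.ge))
      refine le_trans ?_ (ih.resolve_left hj')
      rw [pow_succ p (j + 2), mul_assoc]
      exact Nat.mul_le_mul_left _ (mul_card_le_of_lt hp hG hlt)
  have hab : b + 2 ≤ a := by
    have h := (Nat.mul_le_mul_left (p ^ 2) (Subgroup.card_le_of_le
      (le_sup_right (a := ⁅L, (⊤ : Subgroup G)⁆) (b := pPow p L)))).trans hcard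
    rw [ha, hb, ← pow_add, Nat.pow_le_pow_iff_right hp.one_lt] at h
    omega
  obtain ⟨j, rfl⟩ := Nat.exists_eq_add_of_le hab
  refine ⟨j + 1, (key j).elim id fun h => ?_, by rw [ha, hb, ← pow_add]; congr 1; omega⟩
  have h1 : Nat.card (itComm L (j + 1) ⊔ pPow p L : Subgroup G) ≤ Nat.card (pPow p L) := by
    refine Nat.le_of_mul_le_mul_left (h.trans_eq ?_) (pow_pos hp.pos (j + 2))
    rw [ha, hb, ← pow_add]
    congr 1
    omega
  exact le_sup_left.trans (Subgroup.eq_of_le_of_card_ge le_sup_right h1).ge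

theorem exists_itComm_top_le_iterate_pPow [Finite G] [Group.IsNilpotent G] (hp : p.Prime)
    (hG : IsPGroup p G) {K : ℕ}
    (hcard : ∀ k < K, p ^ 2 * Nat.card
      (⁅(pPow p)^[k] (⊤ : Subgroup G), (⊤ : Subgroup G)⁆ ⊔ (pPow p)^[k + 1] ⊤ : Subgroup G) ≤
        Nat.card ((pPow p)^[k] (⊤ : Subgroup G))) :
    ∃ t, itComm (⊤ : Subgroup G) t ≤ (pPow p)^[K] ⊤ ∧
      Nat.card G = p ^ (t + K) * Nat.card ((pPow p)^[K] (⊤ : Subgroup G)) := by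
  induction K with
  | zero => exact ⟨0, le_rfl, by simp⟩
  | succ K ih =>
    obtain ⟨t, ht, htc⟩ := ih fun k hk => hcard k (hk.trans (Nat.lt_succ_self K))
    have hn : ((pPow p)^[K] (⊤ : Subgroup G)).Normal :=
      Function.Iterate.rec (fun N : Subgroup G => N.Normal) Subgroup.normal_top
        (fun _ => pPow_normal p) K
    have h := hcard K (Nat.lt_succ_self K)
    rw [Function.iterate_succ_apply'] at h ⊢
    obtain ⟨d, hd, hdc⟩ := exists_itComm_le_pPow hp hG h
    refine ⟨t + d, ?_, ?_⟩
    · rw [itComm_add]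
      exact (itComm_mono ht d).trans hd
    · rw [htc, hdc, ← mul_assoc, ← pow_add]
      congr 2
      omega

theorem pow_le_card_itComm_top [Finite G] [Group.IsNilpotent G] (hp : p.Prime) (hG : IsPGroup p G)
    (j t : ℕ) (h : t + j = Group.nilpotencyClass G) :
    p ^ j ≤ Nat.card (itComm (⊤ : Subgroup G) t) := by
  induction j generalizing t with
  | zero => simpa using Nat.one_le_iff_ne_zero.2 Nat.card_pos.ne'
  | succ j ih =>
    refine le_trans ?_ (mul_card_le_of_lt hp hG (H := itComm ⊤ (t + 1)) ?_)
    · rw [pow_succ']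
      exact Nat.mul_le_mul_left p (ih (t + 1) (by omega))
    · refine lt_of_le_of_ne (Subgroup.commutator_top_le_self (itComm ⊤ t)) fun he => ?_
      have hbot : itComm (⊤ : Subgroup G) t ≤ ⊥ :=
        le_of_le_commutator_sup (he.ge.trans le_sup_left)
      rw [itComm_top, le_bot_iff, Subgroup.lowerCentralSeries_eq_bot_iff_nilpotencyClass_le] at hbot
      omega

/-- In a `p`-group of coclass `r`, the sections `L / ⁅L, G⁆ Lᵖ` cannot all have order at least `p²`
for the first `r + 1` terms `L` of the iterated power series of `G`. -/
theorem exists_card_lt_of_coclass [Finite G] [Group.IsNilpotent G] (hp : p.Prime)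
    (hG : IsPGroup p G) {r : ℕ} (hcard : Nat.card G = p ^ (Group.nilpotencyClass G + r)) :
    ∃ k ≤ r, Nat.card ((pPow p)^[k] (⊤ : Subgroup G)) < p ^ 2 * Nat.card
      (⁅(pPow p)^[k] (⊤ : Subgroup G), (⊤ : Subgroup G)⁆ ⊔ (pPow p)^[k + 1] ⊤ : Subgroup G) := by
  by_contra! hcon
  obtain ⟨t, ht, htc⟩ := exists_itComm_top_le_iterate_pPow hp hG (K := r + 1)
    fun k hk => hcon k (Nat.lt_succ_iff.1 hk)
  have h1 : p ^ (Group.nilpotencyClass G - t) ≤ Nat.card ((pPow p)^[r + 1] (⊤ : Subgroup G)) := by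
    rcases le_total t (Group.nilpotencyClass G) with h | h
    · exact (pow_le_card_itComm_top hp hG _ t (by omega)).trans (Subgroup.card_le_of_le ht)
    · rw [Nat.sub_eq_zero_of_le h, pow_zero]
      exact Nat.card_pos
  have h2 := Nat.mul_le_mul_left (p ^ (t + (r + 1))) h1
  rw [← htc, hcard, ← pow_add, Nat.pow_le_pow_iff_right hp.one_lt] at h2
  omega

namespace IsPotentFiltration

variable {M : ℕ → Subgroup G}

theorem itComm_top_le (hp : p.Prime) (hM : IsPotentFiltration p M) (hM0 : M 0 = ⊤) (k : ℕ) :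
    itComm (⊤ : Subgroup G) (k * (p - 1)) ≤ (pPow p)^[k] ⊤ := by
  induction k with
  | zero => simp
  | succ k ih =>
    have hMk := hM.map_iterate_pPow hp k
    rw [add_mul, one_mul, itComm_add, Function.iterate_succ_apply', ← hM0] at *
    exact ((itComm_mono ih _).trans (hMk.potent 0)).trans (pPow_mono (hMk.succ_le 0))

theorem nilpotencyClass_le_pow [Finite G] [Group.IsNilpotent G] (hp : p.Prime) (hG : IsPGroup p G)
    (hM : IsPotentFiltration p M) (hM0 : M 0 = ⊤) {r : ℕ}
    (hcard : Nat.card G = p ^ (Group.nilpotencyClass G + r)) :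
    Group.nilpotencyClass G ≤ p ^ r := by
  obtain ⟨k, hkr, hk⟩ := exists_card_lt_of_coclass hp hG hcard
  rw [Function.iterate_succ_apply'] at hk
  have hbot := hM.commutator_eq_bot_of_card_lt hp hG hM0 rfl hk
  have h1 : itComm (⊤ : Subgroup G) (k * (p - 1) + 1) ≤ ⊥ :=
    (Subgroup.commutator_mono (hM.itComm_top_le hp hM0 k) le_rfl).trans hbot.le
  rw [itComm_top, le_bot_iff, Subgroup.lowerCentralSeries_eq_bot_iff_nilpotencyClass_le] at h1
  refine (h1.trans ?_).trans (Nat.pow_le_pow_right hp.pos hkr)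
  have h2 := one_add_mul_le_pow (a := ((p - 1 : ℕ) : ℤ)) (by omega) k
  have h3 : (1 : ℤ) + ((p - 1 : ℕ) : ℤ) = p := by have := hp.pos; omega
  rw [h3] at h2
  zify
  linarith

end IsPotentFiltration

end

/-- every finite `p`-group of coclass `r` and order at least `p^{2p^r + r}` is
not a PF-group; in particular there are only finitely many PF-groups of coclass `r`. -/
theorem coclass_not_PFGroup {p : ℕ} (hp : p.Prime) (hodd : Odd p)
    {G : Type*} [Group G] [Finite G] [Group.IsNilpotent G] (hG : IsPGroup p G)
    {n r : ℕ} (hcard : Nat.card G = p ^ n)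
    (hco : n = Group.nilpotencyClass G + r)
    (hbig : p ^ (2 * p ^ r + r) ≤ Nat.card G) :
    ¬ PFEmbedded p (⊤ : Subgroup G) := by
  rintro ⟨s, M, hM0, hMs, hle, hnorm, hcent, hpot⟩
  have hM : IsPotentFiltration p M := ⟨hnorm, hle, hcent, hpot, s, hMs⟩
  subst hco
  have hclass := hM.nilpotencyClass_le_pow hp hG hM0 hcard
  rw [hcard, Nat.pow_le_pow_iff_right hp.one_lt] at hbig
  have := pow_pos hp.pos r
  omega
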